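/- arXiv:2106.02395 — 2 statements merged into one kernel-verified Lean document; each statement's English description precedes it below -/
import Mathlib

section
/- Let 𝒴 be a finite nonempty set, let p and q be probability mass functions on 𝒴 with q(y) > 0 whenever p(y) > 0, and let f ∈ 𝒴 be a maximizer of q. Define ĝ = Σ_{y∈𝒴} q(y)², Pe = 1 − p(f), and Δ = 2√(2·KL(p‖q)) where KL(p‖q) = Σ_y p(y) log(p(y)/q(y)). Then Pe ≤ (1 − ĝ) + Δ. -/
theorem kl_term_aux (a b : ℝ) (ha : 0 ≤ a) (hb : 0 ≤ b) (h : 0 < a → 0 < b) :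
    (√a - √b) ^ 2 + (a - b) ≤ a * Real.log (a / b) := by
  have sa := Real.sq_sqrt ha
  have sb := Real.sq_sqrt hb
  rcases ha.eq_or_lt with h0 | h0
  · subst h0
    simp [sb]
  · have hb' := h h0
    have pa := Real.sqrt_pos.2 h0
    have pb := Real.sqrt_pos.2 hb'
    have h1 := Real.log_le_sub_one_of_pos (div_pos pb pa)
    have h2 : Real.log (a / b) = - (2 * Real.log (√b / √a)) := by
      rw [Real.log_div h0.ne' hb'.ne', Real.log_div pb.ne' pa.ne', Real.log_sqrt ha,
        Real.log_sqrt hb]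
      ring
    have h3 : a * (√b / √a) = √a * √b := by
      field_simp
      rw [sa]
    rw [h2]
    nlinarith [mul_le_mul_of_nonneg_left h1 ha]

/-- For pmfs `p, q` on a finite nonempty `𝒴` with `q ≫ p`
(`p y > 0 → q y > 0`), a maximizer `f` of `q`, `ĝ = Σ_y q(y)²`, `Pe = 1 − p(f)` and
`Δ = 2√(2·KL(p‖q))`: `Pe ≤ (1 − ĝ) + Δ`. -/
theorem pe_upper_bound_doctor
    {𝒴 : Type*} [Fintype 𝒴] [Nonempty 𝒴]
    (p q : 𝒴 → ℝ) (hp : ∀ y, 0 ≤ p y) (hq : ∀ y, 0 ≤ q y)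
    (hps : ∑ y, p y = 1) (hqs : ∑ y, q y = 1)
    (hac : ∀ y, 0 < p y → 0 < q y)
    (f : 𝒴) (hf : ∀ y, q y ≤ q f) :
    1 - p f ≤ (1 - ∑ y, (q y) ^ 2)
      + 2 * Real.sqrt (2 * ∑ y, p y * Real.log (p y / q y)) := by
  have hg : ∑ y, (q y) ^ 2 ≤ q f := by
    calc ∑ y, (q y) ^ 2 ≤ ∑ y, q f * q y :=
          Finset.sum_le_sum fun y _ => by nlinarith [hf y, hq y]
      _ = q f := by rw [← Finset.mul_sum, hqs, mul_one]
  have hk : (√(p f) - √(q f)) ^ 2 ≤ ∑ y, p y * Real.log (p y / q y) := by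
    calc (√(p f) - √(q f)) ^ 2 ≤ ∑ y, (√(p y) - √(q y)) ^ 2 :=
          Finset.single_le_sum (f := fun y => (√(p y) - √(q y)) ^ 2)
            (fun y _ => sq_nonneg _) (Finset.mem_univ f)
      _ = ∑ y, ((√(p y) - √(q y)) ^ 2 + (p y - q y)) := by
          rw [Finset.sum_add_distrib, Finset.sum_sub_distrib, hps, hqs]; ring
      _ ≤ _ := Finset.sum_le_sum fun y _ => kl_term_aux _ _ (hp y) (hq y) (hac y)
  have p1 : p f ≤ 1 := hps ▸ Finset.single_le_sum (fun y _ => hp y) (Finset.mem_univ f)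
  have q1 : q f ≤ 1 := hqs ▸ Finset.single_le_sum (fun y _ => hq y) (Finset.mem_univ f)
  have sp1 : √(p f) ≤ 1 := Real.sqrt_le_one.2 p1
  have sq1 : √(q f) ≤ 1 := Real.sqrt_le_one.2 q1
  have sp0 := Real.sqrt_nonneg (p f)
  have sq0 := Real.sqrt_nonneg (q f)
  have ep := Real.sq_sqrt (hp f)
  have eq := Real.sq_sqrt (hq f)
  have hs : |√(p f) - √(q f)| ≤ √(2 * ∑ y, p y * Real.log (p y / q y)) := by
    apply Real.abs_le_sqrt
    nlinarith [sq_nonneg (√(p f) - √(q f))]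
  have hd : q f - p f ≤ 2 * |√(p f) - √(q f)| := by
    have h1 := neg_abs_le (√(p f) - √(q f))
    have h2 := abs_nonneg (√(p f) - √(q f))
    nlinarith
  linarith
end

section
/- Let 𝒴 be a finite nonempty set, let p and q be probability mass functions on 𝒴 with q(y) > 0 whenever p(y) > 0, and let f ∈ 𝒴 be a maximizer of q. Define ĝ = Σ_{y∈𝒴} q(y)², Pe = 1 − p(f), and Δ = 2√(2·KL(p‖q)) where KL(p‖q) = Σ_y p(y) log(p(y)/q(y)). Then (1 − √ĝ) − Δ ≤ Pe. -/
/-- For pmfs `p, q` on a finite nonempty `𝒴` with `q ≫ p`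
(`p y > 0 → q y > 0`), a maximizer `f` of `q`, `ĝ = Σ_y q(y)²`, `Pe = 1 − p(f)` and
`Δ = 2√(2·KL(p‖q))`: `(1 − √ĝ) − Δ ≤ Pe`. -/
theorem pe_lower_bound_doctor
    {𝒴 : Type*} [Fintype 𝒴] [Nonempty 𝒴]
    (p q : 𝒴 → ℝ) (hp : ∀ y, 0 ≤ p y) (hq : ∀ y, 0 ≤ q y)
    (hps : ∑ y, p y = 1) (hqs : ∑ y, q y = 1)
    (hac : ∀ y, 0 < p y → 0 < q y)
    (f : 𝒴) (hf : ∀ y, q y ≤ q f) :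
    (1 - Real.sqrt (∑ y, (q y) ^ 2))
      - 2 * Real.sqrt (2 * ∑ y, p y * Real.log (p y / q y)) ≤ 1 - p f := by
  have hterm : ∀ y, p y - q y + (√(p y) - √(q y)) ^ 2 ≤ p y * Real.log (p y / q y) := by
    intro y
    have ep := Real.sq_sqrt (hp y)
    have eq := Real.sq_sqrt (hq y)
    rcases (hp y).eq_or_lt with h | h
    · rw [← h]
      simp [eq]
    · have h2 := hac y h
      have a := Real.sqrt_pos.2 h
      have b := Real.sqrt_pos.2 h2
      have hl : Real.log (p y / q y) = -2 * Real.log (√(q y) / √(p y)) := by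
        rw [Real.log_div h.ne' h2.ne', Real.log_div b.ne' a.ne', Real.log_sqrt (hp y),
          Real.log_sqrt (hq y)]
        ring
      have h3 := Real.log_le_sub_one_of_pos (div_pos b a)
      have h4 : p y * (√(q y) / √(p y)) = √(p y) * √(q y) := by
        nth_rewrite 1 [← ep]
        field_simp
      have h5 := mul_le_mul_of_nonneg_left h3 (hp y)
      rw [mul_sub, h4] at h5
      rw [hl]
      nlinarith
  have hsum := Finset.sum_le_sum (fun y (_ : y ∈ Finset.univ) => hterm y)
  rw [Finset.sum_add_distrib, Finset.sum_sub_distrib, hps, hqs] at hsum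
  have h1 : (√(p f) - √(q f)) ^ 2 ≤ ∑ y, (√(p y) - √(q y)) ^ 2 :=
    Finset.single_le_sum (f := fun y => (√(p y) - √(q y)) ^ 2)
      (fun y _ => sq_nonneg _) (Finset.mem_univ f)
  have h2 : q f ≤ √(∑ y, (q y) ^ 2) := by
    apply Real.le_sqrt_of_sq_le
    exact Finset.single_le_sum (f := fun y => (q y) ^ 2)
      (fun y _ => sq_nonneg _) (Finset.mem_univ f)
  have hp1 : p f ≤ 1 := hps ▸ Finset.single_le_sum (fun y _ => hp y) (Finset.mem_univ f)
  have hq1 : q f ≤ 1 := hqs ▸ Finset.single_le_sum (fun y _ => hq y) (Finset.mem_univ f)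
  have a1 : √(p f) ≤ 1 := Real.sqrt_le_one.2 hp1
  have b1 : √(q f) ≤ 1 := Real.sqrt_le_one.2 hq1
  have a0 := Real.sqrt_nonneg (p f)
  have b0 := Real.sqrt_nonneg (q f)
  have ep := Real.sq_sqrt (hp f)
  have eq := Real.sq_sqrt (hq f)
  have h3 : |√(p f) - √(q f)| ≤ √(2 * ∑ y, p y * Real.log (p y / q y)) := by
    apply Real.le_sqrt_of_sq_le
    rw [sq_abs]
    nlinarith [sq_nonneg (√(p f) - √(q f))]
  have h4 : p f - q f ≤ 2 * |√(p f) - √(q f)| := by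
    have h5 : p f - q f = (√(p f) - √(q f)) * (√(p f) + √(q f)) := by nlinarith
    rw [h5]
    nlinarith [le_abs_self (√(p f) - √(q f)), abs_nonneg (√(p f) - √(q f))]
  linarith
end
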